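/- Fix row vectors Ψ^{(s)(L,t)} ∈ ℝ^{1 × n_L} and matrices Ψ^{(s,0)(L,t)} ∈ ℝ^{n_0 × n_L} for all L ≥ s > 0, L > t ≥ 0, and real coefficients Φ_{(s,t):pq} (for L ≥ s > t ≥ 0, 1 ≤ p ≤ n_s, 1 ≤ q ≤ n_t), Φ_{(s):p} (for L ≥ s > 0), Φ_{(s,t)(t):p} (for L ≥ s > t > 0), Φ_{(s)(L,t):pq} and Φ_{(s,0)(L,t):pq} (for L ≥ s > 0, L > t ≥ 0), and Φ_1 ∈ ℝ. Define α := Σ_{L≥s>t≥0} Σ_{p,q} Φ_{(s,t):pq}·𝐖^(s,t)_{pq} + Σ_{L≥s>0} Σ_p Φ_{(s):p}·𝐛^(s)_p + Σ_{L≥s>t>0} Σ_p Φ_{(s,t)(t):p}·(𝐖^(s,t)·𝐛^(t))_p + Σ_{L≥s>0, L>t≥0} Σ_{p,q} Φ_{(s)(L,t):pq}·(𝐛^(s)·Ψ^{(s)(L,t)}·𝐖^(L,t))_{pq} + Σ_{L≥s>0, L>t≥0} Σ_{p,q} Φ_{(s,0)(L,t):pq}·(𝐖^(s,0)·Ψ^{(s,0)(L,t)}·𝐖^(L,t))_{pq}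 + Φ_1 ∈ R. If α = 0, then: (1) Φ_{(s,t):pq} = 0 for all L ≥ s > t ≥ 0 with (s,t) ≠ (L,0) and all p, q; (2) for all L ≥ s > 0, L > t ≥ 0 with s ≠ t, either Φ_{(s,0)(L,t):pq} = 0 for all p, q, or Ψ^{(s,0)(L,t)} = 0; (3) Σ_{p,q} Φ_{(L,0):pq}·𝐖^(L,0)_{pq} + Σ_{L>s>0} Σ_{p,q} Φ_{(s,0)(L,s):pq}·(𝐖^(s,0)·Ψ^{(s,0)(L,s)}·𝐖^(L,s))_{pq} = 0; (4) Φ_{(s,t)(t):p} = 0 for all L > s > t > 0 and all p; (5) for all L ≥ s > 0, L > t ≥ 0 with s ≠ t, either Φ_{(s)(L,t):pq} = 0 for all p, q, or Ψ^{(s)(L,t)} = 0; (6) for all L > t > 0, Σ_p Φ_{(L,t)(t):p}·(𝐖^(L,t)·𝐛^(t))_p + Σ_{p,q} Φ_{(t)(L,t):pq}·(𝐛^(t)·Ψ^{(t)(L,t)}·𝐖^(L,t))_{pq} = 0; (7) Φ_{(s):p} = 0 for all L ≥ s > 0 and all p; (8) Φ_1 = 0. -/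

import Mathlib

open Matrix MvPolynomial

noncomputable section

/-- Indeterminates: `Sum.inl (i, j, k)` is `x^(i)_{jk}` and `Sum.inr (i, j)` is `y^(i)_j`. -/
abbrev PVar : Type := (ℕ × ℕ × ℕ) ⊕ (ℕ × ℕ)

/-- The polynomial ring `R` with real coefficients in the indeterminates
`x^(i)_{jk}` and `y^(i)_j`. -/
abbrev Rpoly : Type := MvPolynomial PVar ℝ

/-- The matrix `𝐖^(i)` of indeterminates, with `(j,k)` entry `x^(i)_{jk}`. -/
def Wm (n : ℕ → ℕ) (i : ℕ) : Matrix (Fin (n i)) (Fin (n (i - 1))) Rpoly :=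
  Matrix.of fun j k => MvPolynomial.X (Sum.inl (i, (j : ℕ), (k : ℕ)))

/-- The column vector `𝐛^(i)` of indeterminates, with `j`-th entry `y^(i)_j`. -/
def bm (n : ℕ → ℕ) (i : ℕ) : Matrix (Fin (n i)) (Fin 1) Rpoly :=
  Matrix.of fun j _ => MvPolynomial.X (Sum.inr (i, (j : ℕ)))

/-- The product `𝐖^(s,t) = 𝐖^(s) * 𝐖^(s-1) * ⋯ * 𝐖^(t+1)` of `s - t` matrices. -/
def WmProd (n : ℕ → ℕ) : (s : ℕ) → (t : ℕ) → Matrix (Fin (n s)) (Fin (n t)) Rpoly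
  | s, t =>
    if _h : t < s then Wm n s * WmProd n (s - 1) t
    else Matrix.of fun i j => if (i : ℕ) = (j : ℕ) then (1 : Rpoly) else 0
termination_by s t => s
decreasing_by omega

/-- The entrywise inclusion of a real matrix into matrices over `R`. -/
def toR {m k : Type*} (M : Matrix m k ℝ) : Matrix m k Rpoly :=
  M.map (MvPolynomial.C)

/-- The polynomial `α(Φ, Ψ)`: the general linear combination of all stable polynomial terms. -/
def alphaPoly (L : ℕ) (n : ℕ → ℕ)
    (Ψb : ∀ _s _t : ℕ, Matrix (Fin 1) (Fin (n L)) ℝ)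
    (ΨW : ∀ _s _t : ℕ, Matrix (Fin (n 0)) (Fin (n L)) ℝ)
    (Φst : ∀ s t : ℕ, Fin (n s) → Fin (n t) → ℝ)
    (Φb : ∀ s : ℕ, Fin (n s) → ℝ)
    (ΦWb : ∀ s _t : ℕ, Fin (n s) → ℝ)
    (ΦbW : ∀ s t : ℕ, Fin (n s) → Fin (n t) → ℝ)
    (ΦWW : ∀ s t : ℕ, Fin (n s) → Fin (n t) → ℝ)
    (Φ1 : ℝ) : Rpoly :=
  (∑ s ∈ Finset.Icc 1 L, ∑ t ∈ Finset.range s, ∑ p, ∑ q,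
      MvPolynomial.C (Φst s t p q) * (WmProd n s t) p q)
  + (∑ s ∈ Finset.Icc 1 L, ∑ p, MvPolynomial.C (Φb s p) * (bm n s) p 0)
  + (∑ s ∈ Finset.Icc 1 L, ∑ t ∈ Finset.Ioo 0 s, ∑ p,
      MvPolynomial.C (ΦWb s t p) * (WmProd n s t * bm n t) p 0)
  + (∑ s ∈ Finset.Icc 1 L, ∑ t ∈ Finset.range L, ∑ p, ∑ q,
      MvPolynomial.C (ΦbW s t p q) * (bm n s * toR (Ψb s t) * WmProd n L t) p q)
  + (∑ s ∈ Finset.Icc 1 L, ∑ t ∈ Finset.range L, ∑ p, ∑ q,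
      MvPolynomial.C (ΦWW s t p q) * (WmProd n s 0 * toR (ΨW s t) * WmProd n L t) p q)
  + MvPolynomial.C Φ1

/-- Labels of the summands of `alphaPoly`; the label `bias_W s t` belongs to
`𝐛^(s) Ψ 𝐖^(L,t)`, and `W_W s t` to `𝐖^(s,0) Ψ 𝐖^(L,t)`. -/
inductive StableTerm
  | W (s t : ℕ)
  | bias (s : ℕ)
  | W_bias (s t : ℕ)
  | bias_W (s t : ℕ)
  | W_W (s t : ℕ)
  | one

namespace StableTerm

/-- The index range of the summands of `alphaPoly`. -/
def Admissible (L : ℕ) : StableTerm → Prop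
  | W s t => t < s ∧ s ≤ L
  | bias s => 0 < s ∧ s ≤ L
  | W_bias s t => 0 < t ∧ t < s ∧ s ≤ L
  | bias_W s t => 0 < s ∧ s ≤ L ∧ t < L
  | W_W s t => 0 < s ∧ s ≤ L ∧ t < L
  | one => True

end StableTerm

/-- The multidegree of the entries of `𝐖^(s,t)`, graded by layer. -/
def weightDegree (s t : ℕ) : ℕ ⊕ ℕ → ℕ :=
  Sum.elim (fun i => if t < i ∧ i ≤ s then 1 else 0) 0

/-- The multidegree of the entries of `𝐛^(s)`, graded by layer. -/
def biasDegree (s : ℕ) : ℕ ⊕ ℕ → ℕ :=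
  Sum.elim 0 (fun i => if i = s then 1 else 0)

/-- The layerwise multidegree of the indeterminates. -/
def layerDegree : PVar → (ℕ ⊕ ℕ → ℕ)
  | Sum.inl (i, _, _) => weightDegree i (i - 1)
  | Sum.inr (i, _) => biasDegree i

namespace StableTerm

/-- The layerwise multidegree of a summand of `alphaPoly`. -/
def degree (L : ℕ) : StableTerm → (ℕ ⊕ ℕ → ℕ)
  | W s t => weightDegree s t
  | bias s => biasDegree s
  | W_bias s t => weightDegree s t + biasDegree t
  | bias_W s t => biasDegree s + weightDegree L t
  | W_W s t => weightDegree s 0 + weightDegree L t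
  | one => 0

/-- A representative of the class of all labels with the same multidegree. -/
def representative (L : ℕ) : StableTerm → StableTerm
  | bias_W s t => if s = t then W_bias L t else bias_W s t
  | W_W s t => if s = t then W L 0 else W_W s t
  | τ => τ

theorem representative_eq_of_degree_eq {L : ℕ} {τ τ' : StableTerm} (hτ : τ.Admissible L)
    (hτ' : τ'.Admissible L) (h : τ.degree L = τ'.degree L) :
    τ.representative L = τ'.representative L := by
  have hW : ∀ i, τ.degree L (Sum.inl i) = τ'.degree L (Sum.inl i) := fun i => congrFun h _
  have hb : ∀ i, τ.degree L (Sum.inr i) = τ'.degree L (Sum.inr i) := fun i => congrFun h _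
  clear h
  rcases τ with ⟨s, t⟩ | s | ⟨s, t⟩ | ⟨s, t⟩ | ⟨s, t⟩ | _ <;>
  rcases τ' with ⟨s', t'⟩ | s' | ⟨s', t'⟩ | ⟨s', t'⟩ | ⟨s', t'⟩ | _ <;>
  simp only [degree, weightDegree, biasDegree, Pi.add_apply, Sum.elim_inl, Sum.elim_inr,
    Pi.zero_apply, Admissible, representative, zero_add, add_zero] at * <;>
  (try have b₁ := hb s) <;> (try have b₂ := hb s') <;> (try have b₃ := hb t) <;>
  (try have b₄ := hb t') <;> (try have a₁ := hW s) <;> (try have a₂ := hW s') <;>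
  (try have a₃ := hW (t + 1)) <;> (try have a₄ := hW (t' + 1)) <;>
  (try have a₅ := hW t) <;> (try have a₆ := hW t') <;>
  (try have a₇ := hW (s + 1)) <;> (try have a₈ := hW (s' + 1)) <;>
  clear hW hb <;>
  grind

theorem degree_eq_of_representative_eq {L : ℕ} {τ τ' : StableTerm} (hτ : τ.Admissible L)
    (hτ' : τ'.Admissible L) (h : τ.representative L = τ'.representative L) :
    τ.degree L = τ'.degree L := by
  suffices H : ∀ σ : StableTerm, σ.Admissible L → (σ.representative L).degree L = σ.degree L by
    rw [← H τ hτ, ← H τ' hτ', h]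
  rintro (⟨s, t⟩ | s | ⟨s, t⟩ | ⟨s, t⟩ | ⟨s, t⟩ | _) hσ <;> simp only [representative]
  · split_ifs with hst
    · subst hst
      exact add_comm _ _
    · rfl
  · split_ifs with hst
    · subst hst
      funext i
      cases i <;> simp only [degree, weightDegree, Admissible, Pi.add_apply, Sum.elim_inl, Sum.elim_inr,
        Pi.zero_apply] at *
      · grind
      · rfl
    · rfl

end StableTerm

theorem WmProd_self (n : ℕ → ℕ) (t : ℕ) : WmProd n t t = 1 := by
  rw [WmProd, dif_neg (lt_irrefl t)]
  ext1 p q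
  simp only [Matrix.of_apply, Matrix.one_apply, Fin.ext_iff]

theorem WmProd_succ_apply (n : ℕ → ℕ) {s t : ℕ} (h : t ≤ s) (p : Fin (n (s + 1)))
    (q : Fin (n t)) :
    WmProd n (s + 1) t p q =
      ∑ k : Fin (n s), X (Sum.inl (s + 1, (p : ℕ), (k : ℕ))) * WmProd n s t k q := by
  rw [WmProd, dif_pos (Nat.lt_succ_of_le h)]
  rfl

theorem isWeightedHomogeneous_WmProd (n : ℕ → ℕ) {s t : ℕ} (h : t ≤ s) (p : Fin (n s))
    (q : Fin (n t)) :
    (WmProd n s t p q).IsWeightedHomogeneous layerDegree (weightDegree s t) := by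
  induction s, h using Nat.le_induction with
  | base =>
    have h0 : weightDegree t t = 0 := by
      funext i
      cases i <;> simp only [weightDegree, Sum.elim_inl, Sum.elim_inr, Pi.zero_apply]
      grind
    rw [WmProd_self, h0, Matrix.one_apply]
    split_ifs
    · exact isWeightedHomogeneous_one ℝ _
    · exact isWeightedHomogeneous_zero ℝ _ _
  | succ s hs ih =>
    have hadd : weightDegree (s + 1) t = weightDegree (s + 1) s + weightDegree s t := by
      funext i
      cases i <;> simp only [weightDegree, Pi.add_apply, Sum.elim_inl, Sum.elim_inr,
        Pi.zero_apply, add_zero]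
      grind
    rw [WmProd_succ_apply n hs, hadd]
    exact IsWeightedHomogeneous.sum _ _ _ fun k _ =>
      (isWeightedHomogeneous_X ℝ layerDegree (Sum.inl (s + 1, (p : ℕ), (k : ℕ)))).mul (ih k)

theorem isWeightedHomogeneous_bm (n : ℕ → ℕ) (s : ℕ) (p : Fin (n s)) (q : Fin 1) :
    (bm n s p q).IsWeightedHomogeneous layerDegree (biasDegree s) :=
  isWeightedHomogeneous_X ℝ layerDegree (Sum.inr (s, (p : ℕ)))

/-- Entrywise homogeneity is multiplicative. -/
theorem isWeightedHomogeneous_matrix_mul {σ M R l m o : Type*} [AddCommMonoid M]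
    [CommSemiring R] [Fintype m]
    {w : σ → M} {d e : M} {A : Matrix l m (MvPolynomial σ R)} {B : Matrix m o (MvPolynomial σ R)}
    (hA : ∀ i j, (A i j).IsWeightedHomogeneous w d)
    (hB : ∀ i j, (B i j).IsWeightedHomogeneous w e) (i : l) (j : o) :
    ((A * B) i j).IsWeightedHomogeneous w (d + e) := by
  rw [Matrix.mul_apply]
  exact IsWeightedHomogeneous.sum _ _ _ fun k _ => (hA i k).mul (hB k j)

theorem isWeightedHomogeneous_mul_toR {l m o : Type*} [Fintype m]
    {M : Type*} [AddCommMonoid M] {w : PVar → M} {d : M} {A : Matrix l m Rpoly}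
    (hA : ∀ i j, (A i j).IsWeightedHomogeneous w d) (B : Matrix m o ℝ) (i : l) (j : o) :
    ((A * toR B) i j).IsWeightedHomogeneous w d := by
  rw [← add_zero d]
  exact isWeightedHomogeneous_matrix_mul hA (fun _ _ => isWeightedHomogeneous_C _ _) i j

theorem sum_sum_eq_single {M : Type*} [AddCommMonoid M] {S : Finset ℕ} {T : ℕ → Finset ℕ}
    {f : ℕ → ℕ → M} {s₀ t₀ : ℕ} (hs : s₀ ∈ S) (ht : t₀ ∈ T s₀)
    (hf : ∀ s ∈ S, ∀ t ∈ T s, ¬(s = s₀ ∧ t = t₀) → f s t = 0) :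
    ∑ s ∈ S, ∑ t ∈ T s, f s t = f s₀ t₀ := by
  rw [Finset.sum_eq_single_of_mem s₀ hs, Finset.sum_eq_single_of_mem t₀ ht]
  · exact fun t h hne => hf s₀ hs t h (by tauto)
  · exact fun s h hne => Finset.sum_eq_zero fun t h' => hf s h t h' (by tauto)

namespace StableTerm

/-- The sum of `f` over all admissible labels, arranged as in `alphaPoly`. -/
def sumAdmissible (L : ℕ) (f : StableTerm → Rpoly) : Rpoly :=
  (∑ s ∈ Finset.Icc 1 L, ∑ t ∈ Finset.range s, f (W s t))
  + (∑ s ∈ Finset.Icc 1 L, f (bias s))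
  + (∑ s ∈ Finset.Icc 1 L, ∑ t ∈ Finset.Ioo 0 s, f (W_bias s t))
  + (∑ s ∈ Finset.Icc 1 L, ∑ t ∈ Finset.range L, f (bias_W s t))
  + (∑ s ∈ Finset.Icc 1 L, ∑ t ∈ Finset.range L, f (W_W s t))
  + f one

theorem map_sumAdmissible (L : ℕ) (F : Rpoly →ₗ[ℝ] Rpoly) (f : StableTerm → Rpoly) :
    F (sumAdmissible L f) = sumAdmissible L (fun τ => F (f τ)) := by
  simp only [sumAdmissible, map_add, map_sum]

theorem sumAdmissible_congr {L : ℕ} {f g : StableTerm → Rpoly}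
    (h : ∀ τ : StableTerm, τ.Admissible L → f τ = g τ) :
    sumAdmissible L f = sumAdmissible L g := by
  unfold sumAdmissible
  congr 1
  · congr 1
    · congr 1
      · congr 1
        · congr 1
          all_goals
            refine Finset.sum_congr rfl fun s hs => ?_
            simp only [Finset.mem_Icc] at hs
          · refine Finset.sum_congr rfl fun t ht => h _ ?_
            simp only [Finset.mem_range] at ht
            exact ⟨ht, hs.2⟩
          · exact h _ hs
        all_goals
          refine Finset.sum_congr rfl fun s hs => Finset.sum_congr rfl fun t ht => h _ ?_
          simp only [Finset.mem_Icc, Finset.mem_Ioo] at hs ht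
          exact ⟨ht.1, ht.2, hs.2⟩
      all_goals
        refine Finset.sum_congr rfl fun s hs => Finset.sum_congr rfl fun t ht => h _ ?_
        simp only [Finset.mem_Icc, Finset.mem_range] at hs ht
        exact ⟨hs.1, hs.2, ht⟩
    all_goals
      refine Finset.sum_congr rfl fun s hs => Finset.sum_congr rfl fun t ht => h _ ?_
      simp only [Finset.mem_Icc, Finset.mem_range] at hs ht
      exact ⟨hs.1, hs.2, ht⟩
  · exact h _ trivial

open Classical in
theorem sumAdmissible_eq_single {L : ℕ} {f : StableTerm → Rpoly} {κ : StableTerm}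
    (hκ : κ.Admissible L) (hf : ∀ τ : StableTerm, τ.Admissible L → τ ≠ κ → f τ = 0) :
    sumAdmissible L f = f κ := by
  rw [sumAdmissible_congr (g := fun τ => if τ = κ then f κ else 0) fun τ hτ => by
    split_ifs with h
    · rw [h]
    · exact hf τ hτ h]
  rcases κ with ⟨s, t⟩ | s | ⟨s, t⟩ | ⟨s, t⟩ | ⟨s, t⟩ | _ <;>
    simp only [Admissible] at hκ <;>
    simp only [sumAdmissible, reduceCtorEq, if_false, if_true, Finset.sum_const_zero, add_zero,
      zero_add]
  case bias => simp [Nat.succ_le_iff, hκ]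
  all_goals
    rw [sum_sum_eq_single (s₀ := s) (t₀ := t) (by simp; omega) (by simp; omega), if_pos rfl]
    intro s' _ t' _ hne
    rw [if_neg]
    simpa using hne

open Classical in
/-- A vanishing sum of multihomogeneous terms vanishes on each class of equal multidegree. -/
theorem sumAdmissible_representative_eq_zero {L : ℕ} {P : StableTerm → Rpoly}
    (hP : ∀ τ : StableTerm, τ.Admissible L →
      (P τ).IsWeightedHomogeneous layerDegree (τ.degree L))
    (h : sumAdmissible L P = 0) {κ : StableTerm} (hκ : κ.Admissible L) :
    sumAdmissible L (fun τ => if τ.representative L = κ.representative L then P τ else 0) = 0 := by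
  have h' := congrArg (weightedHomogeneousComponent layerDegree (κ.degree L)) h
  rw [map_zero, map_sumAdmissible] at h'
  refine (sumAdmissible_congr fun τ hτ => ?_).trans h'
  split_ifs with hc
  · rw [degree_eq_of_representative_eq hκ hτ hc.symm,
      (hP τ hτ).weightedHomogeneousComponent_same]
  · rw [(hP τ hτ).weightedHomogeneousComponent_ne]
    exact fun hd => hc (representative_eq_of_degree_eq hτ hκ hd.symm)

theorem eq_zero_of_unique {L : ℕ} {P : StableTerm → Rpoly}
    (hP : ∀ τ : StableTerm, τ.Admissible L →
      (P τ).IsWeightedHomogeneous layerDegree (τ.degree L))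
    (h : sumAdmissible L P = 0) {κ : StableTerm} (hκ : κ.Admissible L)
    (huniq : ∀ τ : StableTerm, τ.representative L = κ.representative L → τ = κ) :
    P κ = 0 := by
  classical
  have := sumAdmissible_representative_eq_zero hP h hκ
  rwa [sumAdmissible_eq_single hκ fun τ _ hne => if_neg fun hr => hne (huniq τ hr),
    if_pos rfl] at this

theorem W_add_sum_W_W_eq_zero {L : ℕ} (hL : 1 ≤ L) {P : StableTerm → Rpoly}
    (hP : ∀ τ : StableTerm, τ.Admissible L →
      (P τ).IsWeightedHomogeneous layerDegree (τ.degree L))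
    (h : sumAdmissible L P = 0) :
    P (W L 0) + ∑ s ∈ Finset.Ioo 0 L, P (W_W s s) = 0 := by
  classical
  have key := sumAdmissible_representative_eq_zero hP h (κ := W L 0) ⟨hL, le_rfl⟩
  have hbW : ∀ s t, (bias_W s t).representative L ≠ W L 0 := by grind [representative]
  have hWW : ∀ s t, (W_W s t).representative L = W L 0 ↔ s = t := by grind [representative]
  simp only [sumAdmissible, show ∀ s t, (W s t).representative L = W s t from fun _ _ => rfl,
    show ∀ s, (bias s).representative L = bias s from fun _ => rfl,
    show ∀ s t, (W_bias s t).representative L = W_bias s t from fun _ _ => rfl,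
    show one.representative L = one from rfl, hbW, hWW, reduceCtorEq, if_false,
    Finset.sum_const_zero, add_zero] at key
  rw [sum_sum_eq_single (s₀ := L) (t₀ := 0) (by simpa using hL) (by simp; omega), if_pos rfl] at key
  · rw [← key]
    simp only [Finset.sum_ite_eq, ← Finset.sum_filter]
    congr 2
    ext s
    simp only [Finset.mem_filter, Finset.mem_Icc, Finset.mem_Ioo, Finset.mem_range]
    omega
  · intro s _ t _ hne
    rw [if_neg]
    simpa using hne

theorem W_bias_add_bias_W_eq_zero {L t : ℕ} (ht : 0 < t) (htL : t < L) {P : StableTerm → Rpoly}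
    (hP : ∀ τ : StableTerm, τ.Admissible L →
      (P τ).IsWeightedHomogeneous layerDegree (τ.degree L))
    (h : sumAdmissible L P = 0) :
    P (W_bias L t) + P (bias_W t t) = 0 := by
  classical
  have key := sumAdmissible_representative_eq_zero hP h (κ := W_bias L t) ⟨ht, htL, le_rfl⟩
  have hbW : ∀ s' t', (bias_W s' t').representative L = W_bias L t ↔ s' = t ∧ t' = t := by
    grind [representative]
  have hWW : ∀ s' t', (W_W s' t').representative L ≠ W_bias L t := by grind [representative]
  simp only [sumAdmissible, show ∀ s t, (W s t).representative L = W s t from fun _ _ => rfl,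
    show ∀ s, (bias s).representative L = bias s from fun _ => rfl,
    show ∀ s t, (W_bias s t).representative L = W_bias s t from fun _ _ => rfl,
    show one.representative L = one from rfl, hbW, hWW, reduceCtorEq, if_false,
    Finset.sum_const_zero, add_zero, zero_add] at key
  rw [sum_sum_eq_single (s₀ := L) (t₀ := t) (by simp; omega) (by simp; omega), if_pos rfl,
    sum_sum_eq_single (s₀ := t) (t₀ := t) (by simp; omega) (by simpa using htL),
    if_pos ⟨rfl, rfl⟩] at key
  · exact key
  · exact fun _ _ _ _ hne => if_neg hne
  · intro s _ t _ hne
    rw [if_neg]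
    simpa using hne

end StableTerm

/-- The substitution making every `𝐖^(i)` a generic matrix of rank one: `x^(i)_{jk}` becomes
`u_{i,j} * v_{i-1,k}`. The indeterminates `u`, `v` and the images of `y` are tagged
by `0`, `1` and `2` respectively. -/
def rankOneSubst : Rpoly →ₐ[ℝ] MvPolynomial (Fin 3 × ℕ × ℕ) ℝ :=
  aeval (Sum.elim (fun a => X (0, a.1, a.2.1) * X (1, a.1 - 1, a.2.2)) fun a => X (2, a.1, a.2))

theorem eq_zero_of_sum_C_mul_X_eq_zero {a : Fin 3} {s m : ℕ} {Φ : Fin m → ℝ}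
    (h : ∑ p, C (Φ p) * X (a, s, (p : ℕ)) = (0 : MvPolynomial (Fin 3 × ℕ × ℕ) ℝ)) (p : Fin m) :
    Φ p = 0 := by
  have h' := congrArg (eval fun x => if x = (a, s, (p : ℕ)) then 1 else 0) h
  simpa [map_sum, Fin.val_inj] using h'

theorem eq_zero_of_sum_C_mul_X_mul_X_eq_zero {a b : Fin 3} (hab : a ≠ b) {s t m k : ℕ}
    {Φ : Fin m → Fin k → ℝ}
    (h : ∑ p, ∑ q, C (Φ p q) * (X (a, s, (p : ℕ)) * X (b, t, (q : ℕ))) =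
      (0 : MvPolynomial (Fin 3 × ℕ × ℕ) ℝ)) (p : Fin m) (q : Fin k) :
    Φ p q = 0 := by
  have h' := congrArg
    (eval fun x => if x = (a, s, (p : ℕ)) ∨ x = (b, t, (q : ℕ)) then 1 else 0) h
  simpa [map_sum, Fin.val_inj, hab, hab.symm] using h'

theorem sum_X_mul_X_ne_zero {a b : Fin 3} {s t m : ℕ} (hm : 1 ≤ m) :
    ∑ p : Fin m, X (a, s, (p : ℕ)) * X (b, t, (p : ℕ)) ≠
      (0 : MvPolynomial (Fin 3 × ℕ × ℕ) ℝ) := by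
  intro h
  have h' := congrArg (eval fun _ => 1) h
  simp [map_sum] at h'
  omega

theorem rankOneSubst_bm (n : ℕ → ℕ) (i : ℕ) (p : Fin (n i)) (q : Fin 1) :
    rankOneSubst (bm n i p q) = X (2, i, (p : ℕ)) := by
  simp [rankOneSubst, bm]

theorem rankOneSubst_C (r : ℝ) : rankOneSubst (C r) = C r :=
  rankOneSubst.commutes r

theorem exists_rankOneSubst_WmProd (n : ℕ → ℕ) (hn : ∀ i, 1 ≤ n i) {s t : ℕ} (h : t < s) :
    ∃ g : MvPolynomial (Fin 3 × ℕ × ℕ) ℝ, g ≠ 0 ∧ ∀ p q,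
      rankOneSubst (WmProd n s t p q) = X (0, s, (p : ℕ)) * X (1, t, (q : ℕ)) * g := by
  induction s, h using Nat.le_induction with
  | base =>
    refine ⟨1, one_ne_zero, fun p q => ?_⟩
    rw [WmProd_succ_apply n le_rfl, WmProd_self, Finset.sum_eq_single q]
    · simp [rankOneSubst]
    · intro k _ hk
      simp [hk]
    · simp
  | succ s hs ih =>
    obtain ⟨g, hg, hgW⟩ := ih
    refine ⟨(∑ k : Fin (n s), X (1, s, (k : ℕ)) * X (0, s, (k : ℕ))) * g,
      mul_ne_zero (sum_X_mul_X_ne_zero (hn s)) hg, fun p q => ?_⟩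
    rw [WmProd_succ_apply n (Nat.le_of_succ_le hs), map_sum, Finset.sum_mul, Finset.mul_sum]
    refine Finset.sum_congr rfl fun k _ => ?_
    rw [map_mul, hgW k q, rankOneSubst, aeval_X]
    simp only [Sum.elim_inl, Nat.add_sub_cancel]
    ring

/-- The summand of `alphaPoly` with a given label. -/
def stableSummand (L : ℕ) (n : ℕ → ℕ)
    (Ψb : ∀ _s _t : ℕ, Matrix (Fin 1) (Fin (n L)) ℝ)
    (ΨW : ∀ _s _t : ℕ, Matrix (Fin (n 0)) (Fin (n L)) ℝ)
    (Φst : ∀ s t : ℕ, Fin (n s) → Fin (n t) → ℝ)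
    (Φb : ∀ s : ℕ, Fin (n s) → ℝ)
    (ΦWb : ∀ s _t : ℕ, Fin (n s) → ℝ)
    (ΦbW : ∀ s t : ℕ, Fin (n s) → Fin (n t) → ℝ)
    (ΦWW : ∀ s t : ℕ, Fin (n s) → Fin (n t) → ℝ)
    (Φ1 : ℝ) : StableTerm → Rpoly
  | .W s t => ∑ p, ∑ q, C (Φst s t p q) * (WmProd n s t) p q
  | .bias s => ∑ p, C (Φb s p) * (bm n s) p 0
  | .W_bias s t => ∑ p, C (ΦWb s t p) * (WmProd n s t * bm n t) p 0
  | .bias_W s t => ∑ p, ∑ q, C (ΦbW s t p q) * (bm n s * toR (Ψb s t) * WmProd n L t) p q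
  | .W_W s t => ∑ p, ∑ q, C (ΦWW s t p q) * (WmProd n s 0 * toR (ΨW s t) * WmProd n L t) p q
  | .one => C Φ1

theorem isWeightedHomogeneous_stableSummand (L : ℕ) (n : ℕ → ℕ)
    (Ψb : ∀ _s _t : ℕ, Matrix (Fin 1) (Fin (n L)) ℝ)
    (ΨW : ∀ _s _t : ℕ, Matrix (Fin (n 0)) (Fin (n L)) ℝ)
    (Φst : ∀ s t : ℕ, Fin (n s) → Fin (n t) → ℝ)
    (Φb : ∀ s : ℕ, Fin (n s) → ℝ)
    (ΦWb : ∀ s _t : ℕ, Fin (n s) → ℝ)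
    (ΦbW : ∀ s t : ℕ, Fin (n s) → Fin (n t) → ℝ)
    (ΦWW : ∀ s t : ℕ, Fin (n s) → Fin (n t) → ℝ)
    (Φ1 : ℝ) (τ : StableTerm) (hτ : τ.Admissible L) :
    (stableSummand L n Ψb ΨW Φst Φb ΦWb ΦbW ΦWW Φ1 τ).IsWeightedHomogeneous layerDegree
      (τ.degree L) := by
  have hL : ∀ {t}, t < L → ∀ p q,
      (WmProd n L t p q).IsWeightedHomogeneous layerDegree (weightDegree L t) :=
    fun ht => isWeightedHomogeneous_WmProd n ht.le
  rcases τ with ⟨s, t⟩ | s | ⟨s, t⟩ | ⟨s, t⟩ | ⟨s, t⟩ | _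
  · exact .sum _ _ _ fun p _ => .sum _ _ _ fun q _ =>
      (isWeightedHomogeneous_WmProd n hτ.1.le p q).C_mul _
  · exact .sum _ _ _ fun p _ => (isWeightedHomogeneous_bm n s p 0).C_mul _
  · exact .sum _ _ _ fun p _ => (isWeightedHomogeneous_matrix_mul
      (isWeightedHomogeneous_WmProd n hτ.2.1.le) (isWeightedHomogeneous_bm n t) p 0).C_mul _
  · exact .sum _ _ _ fun p _ => .sum _ _ _ fun q _ => (isWeightedHomogeneous_matrix_mul
      (isWeightedHomogeneous_mul_toR (isWeightedHomogeneous_bm n s) _) (hL hτ.2.2) p q).C_mul _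
  · exact .sum _ _ _ fun p _ => .sum _ _ _ fun q _ => (isWeightedHomogeneous_matrix_mul
      (isWeightedHomogeneous_mul_toR (isWeightedHomogeneous_WmProd n (Nat.zero_le s)) _)
      (hL hτ.2.2) p q).C_mul _
  · exact isWeightedHomogeneous_C _ _


theorem coeff_eq_zero_of_sum_WmProd_eq_zero {n : ℕ → ℕ} (hn : ∀ i, 1 ≤ n i) {s t : ℕ} (hts : t < s)
    {Φ : Fin (n s) → Fin (n t) → ℝ}
    (h : ∑ p, ∑ q, C (Φ p q) * WmProd n s t p q = 0) (p : Fin (n s)) (q : Fin (n t)) :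
    Φ p q = 0 := by
  obtain ⟨g, hg, hgW⟩ := exists_rankOneSubst_WmProd n hn hts
  have h' := congrArg rankOneSubst h
  simp only [map_sum, map_mul, rankOneSubst_C, hgW, map_zero, ← mul_assoc, ← Finset.sum_mul] at h'
  refine eq_zero_of_sum_C_mul_X_mul_X_eq_zero (a := 0) (b := 1) (s := s) (t := t)
    (by decide) ?_ p q
  simpa only [mul_assoc] using (mul_eq_zero.mp h').resolve_right hg

theorem coeff_eq_zero_of_sum_bm_eq_zero {n : ℕ → ℕ} {s : ℕ} {Φ : Fin (n s) → ℝ}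
    (h : ∑ p, C (Φ p) * bm n s p 0 = 0) (p : Fin (n s)) : Φ p = 0 := by
  have h' := congrArg rankOneSubst h
  simp only [map_sum, map_mul, rankOneSubst_C, rankOneSubst_bm, map_zero] at h'
  exact eq_zero_of_sum_C_mul_X_eq_zero h' p

theorem coeff_eq_zero_of_sum_WmProd_mul_bm_eq_zero {n : ℕ → ℕ} (hn : ∀ i, 1 ≤ n i) {s t : ℕ}
    (hts : t < s) {Φ : Fin (n s) → ℝ}
    (h : ∑ p, C (Φ p) * (WmProd n s t * bm n t) p 0 = 0) (p : Fin (n s)) : Φ p = 0 := by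
  obtain ⟨g, hg, hgW⟩ := exists_rankOneSubst_WmProd n hn hts
  have h' := congrArg rankOneSubst h
  have hfac : rankOneSubst (∑ p, C (Φ p) * (WmProd n s t * bm n t) p 0) =
      (∑ p, C (Φ p) * X (0, s, (p : ℕ))) *
        (g * ∑ k : Fin (n t), X (1, t, (k : ℕ)) * X (2, t, (k : ℕ))) := by
    simp only [map_sum, map_mul, rankOneSubst_C, Matrix.mul_apply, hgW, rankOneSubst_bm,
      Finset.sum_mul]
    simp only [Finset.mul_sum]
    exact Finset.sum_congr rfl fun _ _ => Finset.sum_congr rfl fun _ _ => by ring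
  rw [hfac, map_zero] at h'
  exact eq_zero_of_sum_C_mul_X_eq_zero
    ((mul_eq_zero.mp h').resolve_right (mul_ne_zero hg (sum_X_mul_X_ne_zero (hn t)))) p

theorem eq_zero_or_eq_zero_of_sum_bm_mul_WmProd_eq_zero {n : ℕ → ℕ} (hn : ∀ i, 1 ≤ n i)
    {L s t : ℕ} (htL : t < L) {Ψ : Matrix (Fin 1) (Fin (n L)) ℝ}
    {Φ : Fin (n s) → Fin (n t) → ℝ}
    (h : ∑ p, ∑ q, C (Φ p q) * (bm n s * toR Ψ * WmProd n L t) p q = 0) :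
    (∀ p q, Φ p q = 0) ∨ Ψ = 0 := by
  obtain ⟨g, hg, hgW⟩ := exists_rankOneSubst_WmProd n hn htL
  have h' := congrArg rankOneSubst h
  have hfac : rankOneSubst (∑ p, ∑ q, C (Φ p q) * (bm n s * toR Ψ * WmProd n L t) p q) =
      (∑ p, ∑ q, C (Φ p q) * (X (2, s, (p : ℕ)) * X (1, t, (q : ℕ)))) *
        (∑ k : Fin (n L), C (Ψ 0 k) * X (0, L, (k : ℕ))) * g := by
    simp only [map_sum, map_mul, rankOneSubst_C, Matrix.mul_apply, hgW, rankOneSubst_bm, toR,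
      Matrix.map_apply, Finset.sum_mul, Finset.univ_unique, Finset.sum_singleton]
    simp only [Finset.mul_sum, Finset.sum_mul]
    exact Finset.sum_congr rfl fun _ _ => Finset.sum_congr rfl fun _ _ =>
      Finset.sum_congr rfl fun _ _ => by simp only [Fin.default_eq_zero]; ring
  rw [hfac, map_zero] at h'
  rcases mul_eq_zero.mp ((mul_eq_zero.mp h').resolve_right hg) with h₀ | h₀
  · exact Or.inl (eq_zero_of_sum_C_mul_X_mul_X_eq_zero (by decide) h₀)
  · refine Or.inr (Matrix.ext fun i k => ?_)
    rw [Subsingleton.elim i 0]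
    exact eq_zero_of_sum_C_mul_X_eq_zero h₀ k

theorem eq_zero_or_eq_zero_of_sum_WmProd_mul_WmProd_eq_zero {n : ℕ → ℕ} (hn : ∀ i, 1 ≤ n i)
    {L s t : ℕ} (hs : 0 < s) (htL : t < L) {Ψ : Matrix (Fin (n 0)) (Fin (n L)) ℝ}
    {Φ : Fin (n s) → Fin (n t) → ℝ}
    (h : ∑ p, ∑ q, C (Φ p q) * (WmProd n s 0 * toR Ψ * WmProd n L t) p q = 0) :
    (∀ p q, Φ p q = 0) ∨ Ψ = 0 := by
  obtain ⟨g, hg, hgW⟩ := exists_rankOneSubst_WmProd n hn htL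
  obtain ⟨g', hg', hgW'⟩ := exists_rankOneSubst_WmProd n hn hs
  have h' := congrArg rankOneSubst h
  have hfac : rankOneSubst (∑ p, ∑ q, C (Φ p q) * (WmProd n s 0 * toR Ψ * WmProd n L t) p q) =
      (∑ p, ∑ q, C (Φ p q) * (X (0, s, (p : ℕ)) * X (1, t, (q : ℕ)))) *
        (∑ k : Fin (n L), ∑ j : Fin (n 0),
          C (Ψ j k) * (X (1, 0, (j : ℕ)) * X (0, L, (k : ℕ)))) * (g * g') := by
    simp only [map_sum, map_mul, rankOneSubst_C, Matrix.mul_apply, hgW, hgW', toR,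
      Matrix.map_apply, Finset.sum_mul]
    simp only [Finset.mul_sum, Finset.sum_mul]
    exact Finset.sum_congr rfl fun _ _ => Finset.sum_congr rfl fun _ _ =>
      Finset.sum_congr rfl fun _ _ => Finset.sum_congr rfl fun _ _ => by ring
  rw [hfac, map_zero] at h'
  rcases mul_eq_zero.mp ((mul_eq_zero.mp h').resolve_right (mul_ne_zero hg hg')) with h₀ | h₀
  · exact Or.inl (eq_zero_of_sum_C_mul_X_mul_X_eq_zero (by decide) h₀)
  · rw [Finset.sum_comm] at h₀
    exact Or.inr (Matrix.ext (eq_zero_of_sum_C_mul_X_mul_X_eq_zero (by decide) h₀))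

/-- necessary conditions on the coefficients when `α(Φ, Ψ) = 0`. -/
theorem alphaPoly_eq_zero_necessary (L : ℕ) (hL : 1 ≤ L) (n : ℕ → ℕ) (hn : ∀ i, 1 ≤ n i)
    (Ψb : ∀ _s _t : ℕ, Matrix (Fin 1) (Fin (n L)) ℝ)
    (ΨW : ∀ _s _t : ℕ, Matrix (Fin (n 0)) (Fin (n L)) ℝ)
    (Φst : ∀ s t : ℕ, Fin (n s) → Fin (n t) → ℝ)
    (Φb : ∀ s : ℕ, Fin (n s) → ℝ)
    (ΦWb : ∀ s _t : ℕ, Fin (n s) → ℝ)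
    (ΦbW : ∀ s t : ℕ, Fin (n s) → Fin (n t) → ℝ)
    (ΦWW : ∀ s t : ℕ, Fin (n s) → Fin (n t) → ℝ)
    (Φ1 : ℝ)
    (h : alphaPoly L n Ψb ΨW Φst Φb ΦWb ΦbW ΦWW Φ1 = 0) :
    -- (1)
    (∀ s t : ℕ, t < s → s ≤ L → ¬(s = L ∧ t = 0) → ∀ p q, Φst s t p q = 0) ∧
    -- (2)
    (∀ s t : ℕ, 0 < s → s ≤ L → t < L → s ≠ t →
      (∀ p q, ΦWW s t p q = 0) ∨ ΨW s t = 0) ∧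
    -- (3)
    ((∑ p, ∑ q, MvPolynomial.C (Φst L 0 p q) * (WmProd n L 0) p q)
      + (∑ s ∈ Finset.Ioo 0 L, ∑ p, ∑ q, MvPolynomial.C (ΦWW s s p q) *
          (WmProd n s 0 * toR (ΨW s s) * WmProd n L s) p q) = (0 : Rpoly)) ∧
    -- (4)
    (∀ s t : ℕ, s < L → t < s → 0 < t → ∀ p, ΦWb s t p = 0) ∧
    -- (5)
    (∀ s t : ℕ, 0 < s → s ≤ L → t < L → s ≠ t →
      (∀ p q, ΦbW s t p q = 0) ∨ Ψb s t = 0) ∧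
    -- (6)
    (∀ t : ℕ, 0 < t → t < L →
      (∑ p, MvPolynomial.C (ΦWb L t p) * (WmProd n L t * bm n t) p 0)
        + (∑ p, ∑ q, MvPolynomial.C (ΦbW t t p q) *
            (bm n t * toR (Ψb t t) * WmProd n L t) p q) = (0 : Rpoly)) ∧
    -- (7)
    (∀ s : ℕ, 0 < s → s ≤ L → ∀ p, Φb s p = 0) ∧
    -- (8)
    (Φ1 = 0) := by
  have hP := isWeightedHomogeneous_stableSummand L n Ψb ΨW Φst Φb ΦWb ΦbW ΦWW Φ1
  have hsum : StableTerm.sumAdmissible L (stableSummand L n Ψb ΨW Φst Φb ΦWb ΦbW ΦWW Φ1) = 0 := h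
  refine ⟨?_, ?_, StableTerm.W_add_sum_W_W_eq_zero hL hP hsum, ?_, ?_, ?_, ?_, ?_⟩
  · intro s t hts hs hne
    refine coeff_eq_zero_of_sum_WmProd_eq_zero hn hts
      (StableTerm.eq_zero_of_unique hP hsum (κ := .W s t) ⟨hts, hs⟩ fun τ hτ => ?_)
    cases τ <;> grind [StableTerm.representative]
  · intro s t hs hsL htL hne
    refine eq_zero_or_eq_zero_of_sum_WmProd_mul_WmProd_eq_zero hn hs htL
      (StableTerm.eq_zero_of_unique hP hsum (κ := .W_W s t) ⟨hs, hsL, htL⟩ fun τ hτ => ?_)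
    cases τ <;> grind [StableTerm.representative]
  · intro s t hsL hts ht
    refine coeff_eq_zero_of_sum_WmProd_mul_bm_eq_zero hn hts
      (StableTerm.eq_zero_of_unique hP hsum (κ := .W_bias s t) ⟨ht, hts, hsL.le⟩ fun τ hτ => ?_)
    cases τ <;> grind [StableTerm.representative]
  · intro s t hs hsL htL hne
    refine eq_zero_or_eq_zero_of_sum_bm_mul_WmProd_eq_zero hn htL
      (StableTerm.eq_zero_of_unique hP hsum (κ := .bias_W s t) ⟨hs, hsL, htL⟩ fun τ hτ => ?_)
    cases τ <;> grind [StableTerm.representative]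
  · exact fun t ht htL => StableTerm.W_bias_add_bias_W_eq_zero ht htL hP hsum
  · intro s hs hsL
    refine coeff_eq_zero_of_sum_bm_eq_zero
      (StableTerm.eq_zero_of_unique hP hsum (κ := .bias s) ⟨hs, hsL⟩ fun τ hτ => ?_)
    cases τ <;> grind [StableTerm.representative]
  · refine (C_eq_zero (σ := PVar)).mp
      (StableTerm.eq_zero_of_unique hP hsum (κ := .one) trivial fun τ hτ => ?_)
    cases τ <;> grind [StableTerm.representative]
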